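/- Let μ, ν₁, ν₂ be probability measures on the configuration space X with μ ⪯ ν₁ and μ ⪯ ν₂, and suppose μ = λ • ν₁ + (1 − λ) • ν₂ for some λ ∈ (0,1). Then ν₁ = ν₂ = μ. -/

import Mathlib

open MeasureTheory Filter Topology
open scoped NNReal

/-- The configuration space `X = {0,1}^ℕ` (with the product topology, pointwise order
and Borel σ-algebra, all provided by the standard instances). -/
abbrev Config : Type := ℕ → Bool

/-- Stochastic domination: `μ ⪯ ν` iff `∫ f dμ ≤ ∫ f dν` for every continuous monotone
`f : X → ℝ`. -/
def StochDom (μ ν : Measure Config) : Prop :=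
  ∀ f : Config → ℝ, Continuous f → Monotone f → ∫ x, f x ∂μ ≤ ∫ x, f x ∂ν

/-- The increasing cylinder set attached to a finite set of sites. -/
def upCyl (F : Finset ℕ) : Set Config := {x | ∀ i ∈ F, x i = true}

lemma upCyl_isClopen (F : Finset ℕ) : IsClopen (upCyl F) := by
  have : upCyl F = ⋂ i ∈ F, (fun x : Config => x i) ⁻¹' {true} := by
    ext x; simp [upCyl]
  rw [this]
  exact isClopen_biInter_finset fun i _ => (isClopen_discrete _).preimage (continuous_apply i)

lemma upCyl_monotone (F : Finset ℕ) :
    Monotone ((upCyl F).indicator (fun _ => (1 : ℝ))) := by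
  intro x y hxy
  by_cases hx : x ∈ upCyl F
  · have hy : y ∈ upCyl F := by
      intro i hi
      have h1 := hxy i
      rw [hx i hi] at h1
      exact top_le_iff.mp h1
    simp [hx, hy]
  · rw [Set.indicator_of_notMem hx]
    exact Set.indicator_nonneg (fun _ _ => zero_le_one) _

lemma config_generateFrom :
    (inferInstance : MeasurableSpace Config) = MeasurableSpace.generateFrom (Set.range upCyl) := by
  apply le_antisymm
  · refine iSup_le fun i => ?_
    have : @Measurable Config Bool (MeasurableSpace.generateFrom (Set.range upCyl)) _
        (fun x => x i) := by
      refine @measurable_to_bool _ (MeasurableSpace.generateFrom (Set.range upCyl)) _ ?_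
      apply MeasurableSpace.measurableSet_generateFrom
      refine ⟨{i}, ?_⟩
      ext x; simp [upCyl]
    exact this.comap_le
  · apply MeasurableSpace.generateFrom_le
    rintro _ ⟨F, rfl⟩
    exact (upCyl_isClopen F).isOpen.measurableSet

lemma eq_of_integral_mono (μ ν : Measure Config) [IsProbabilityMeasure μ]
    [IsProbabilityMeasure ν]
    (h : ∀ f : Config → ℝ, Continuous f → Monotone f → ∫ x, f x ∂μ = ∫ x, f x ∂ν) :
    μ = ν := by
  refine ext_of_generate_finite (Set.range upCyl) config_generateFrom ?_ ?_ (by simp)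
  · rintro _ ⟨F, rfl⟩ _ ⟨G, rfl⟩ _
    refine ⟨F ∪ G, ?_⟩
    ext x
    simp only [upCyl, Finset.mem_union, Set.mem_ofPred_eq, Set.mem_inter_iff]
    grind
  · rintro _ ⟨F, rfl⟩
    have hc : Continuous ((upCyl F).indicator (fun _ => (1 : ℝ))) :=
      continuous_const.indicator (fun a ha => by simp [(upCyl_isClopen F).frontier_eq] at ha)
    have := h _ hc (upCyl_monotone F)
    rw [integral_indicator_const _ (upCyl_isClopen F).isOpen.measurableSet,
      integral_indicator_const _ (upCyl_isClopen F).isOpen.measurableSet] at this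
    simpa [Measure.real, ENNReal.toReal_eq_toReal_iff' (measure_ne_top _ _)
      (measure_ne_top _ _)] using this

/-- If a probability measure `μ` on `X` is stochastically dominated by both `ν₁` and
`ν₂` and is a proper convex combination `μ = λ • ν₁ + (1 - λ) • ν₂` of them, then
`ν₁ = ν₂ = μ`. -/
theorem convex_combination_dominating
    (μ ν₁ ν₂ : Measure Config)
    (hμ : IsProbabilityMeasure μ) (hν₁ : IsProbabilityMeasure ν₁)
    (hν₂ : IsProbabilityMeasure ν₂)
    (h₁ : StochDom μ ν₁) (h₂ : StochDom μ ν₂)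
    (l : ℝ) (hl0 : 0 < l) (hl1 : l < 1)
    (hcomb : μ = ENNReal.ofReal l • ν₁ + ENNReal.ofReal (1 - l) • ν₂) :
    ν₁ = μ ∧ ν₂ = μ := by
  have key : ∀ f : Config → ℝ, Continuous f → Monotone f →
      ∫ x, f x ∂ν₁ = ∫ x, f x ∂μ ∧ ∫ x, f x ∂ν₂ = ∫ x, f x ∂μ := by
    intro f hf hm
    have a := h₁ f hf hm
    have b := h₂ f hf hm
    have hint : ∀ ν : Measure Config, IsProbabilityMeasure ν → Integrable f ν := fun ν _ =>
      hf.integrable_of_hasCompactSupport (HasCompactSupport.of_compactSpace f)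
    have c : ∫ x, f x ∂μ = l * ∫ x, f x ∂ν₁ + (1 - l) * ∫ x, f x ∂ν₂ := by
      rw [hcomb, integral_add_measure ((hint ν₁ hν₁).smul_measure ENNReal.ofReal_ne_top)
        ((hint ν₂ hν₂).smul_measure ENNReal.ofReal_ne_top), integral_smul_measure,
        integral_smul_measure, ENNReal.toReal_ofReal hl0.le,
        ENNReal.toReal_ofReal (by linarith), smul_eq_mul, smul_eq_mul]
    have hl1' : 0 < 1 - l := by linarith
    constructor
    · apply le_antisymm _ a
      by_contra! hlt
      nlinarith [mul_pos hl0 (sub_pos.2 hlt), mul_nonneg hl1'.le (sub_nonneg.2 b)]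
    · apply le_antisymm _ b
      by_contra! hlt
      nlinarith [mul_pos hl1' (sub_pos.2 hlt), mul_nonneg hl0.le (sub_nonneg.2 a)]
  exact ⟨eq_of_integral_mono _ _ fun f hf hm => (key f hf hm).1,
    eq_of_integral_mono _ _ fun f hf hm => (key f hf hm).2⟩
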